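/- arXiv:0711.1867 — 2 statements merged into one kernel-verified Lean document; each statement's English description precedes it below -/
import Mathlib

section
/- Let K ⊂ ℝ^n be a convex body of class C²₊ with centroid at the origin. Then for every real t < −n, n|K°| · (n|K|)^{n/t} ≤ as_t(K)^{(n+t)/t}. -/
open MeasureTheory Filter Set
open scoped RealInnerProductSpace Topology NNReal ENNReal

noncomputable section

namespace LpAffine

/-- Euclidean space ℝⁿ. -/
abbrev E (n : ℕ) := EuclideanSpace ℝ (Fin n)

/-- A convex body: a compact convex set with nonempty interior. -/
def IsConvexBody {n : ℕ} (K : Set (E n)) : Prop :=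
  Convex ℝ K ∧ IsCompact K ∧ (interior K).Nonempty

/-- The polar body `K° = {y : ⟪x,y⟫ ≤ 1 ∀ x ∈ K}`. -/
def polarBody {n : ℕ} (K : Set (E n)) : Set (E n) := {y | ∀ x ∈ K, ⟪x, y⟫ ≤ 1}

/-- n-dimensional volume (Lebesgue). -/
def vol {n : ℕ} (K : Set (E n)) : ℝ := (volume K).toReal

/-- (n-1)-dimensional Hausdorff measure on ℝⁿ, used as boundary (surface) measure. -/
def bdMeasure (n : ℕ) : Measure (E n) := μH[(n : ℝ) - 1]

/-- The surface area measure μ_K on ∂K. -/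
def surfaceMeasure {n : ℕ} (K : Set (E n)) : Measure (E n) :=
  (bdMeasure n).restrict (frontier K)

/-- The centroid (center of gravity) of K is at the origin. -/
def CentroidAtOrigin {n : ℕ} (K : Set (E n)) : Prop := (∫ x in K, x) = (0 : E n)

/-- ν is an outer unit normal map for K: at each boundary point x, ν x is a unit vector
and the hyperplane through x with normal ν x supports K. -/
def IsOuterNormal {n : ℕ} (K : Set (E n)) (ν : E n → E n) : Prop :=
  ∀ x ∈ frontier K, ‖ν x‖ = 1 ∧ ∀ z ∈ K, ⟪z, ν x⟫ ≤ ⟪x, ν x⟫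

/-- k is the (generalized) Gaussian curvature of K at the boundary point x:
the density of the spherical image measure with respect to the surface measure at x. -/
def IsGaussCurvatureAt {n : ℕ} (K : Set (E n)) (ν : E n → E n) (x : E n) (k : ℝ) : Prop :=
  Tendsto (fun ε : ℝ =>
      (bdMeasure n (ν '' (frontier K ∩ Metric.ball x ε))).toReal /
        (bdMeasure n (frontier K ∩ Metric.ball x ε)).toReal)
    (𝓝[>] 0) (𝓝 k)

/-- κ is a generalized Gauss curvature function for K (defined μ_K-almost everywhere). -/
def IsGaussCurvature {n : ℕ} (K : Set (E n)) (ν : E n → E n) (κ : E n → ℝ) : Prop :=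
  ∀ᵐ x ∂(surfaceMeasure K), IsGaussCurvatureAt K ν x (κ x)

/-- K is of class C²₊ with outer normal map ν and Gaussian curvature κ:
K is a convex body, ν is a continuous outer normal map which maps ∂K bijectively onto the
unit sphere, and κ is a continuous, everywhere strictly positive Gaussian curvature. -/
def IsC2PlusBody {n : ℕ} (K : Set (E n)) (ν : E n → E n) (κ : E n → ℝ) : Prop :=
  IsConvexBody K ∧ IsOuterNormal K ν ∧
    ContinuousOn ν (frontier K) ∧ ContinuousOn κ (frontier K) ∧
    Set.BijOn ν (frontier K) (Metric.sphere (0 : E n) 1) ∧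
    ∀ x ∈ frontier K, IsGaussCurvatureAt K ν x (κ x) ∧ 0 < κ x

/-- The L_p affine surface area
`as_p(K) = ∫_{∂K} κ(x)^{p/(n+p)} / ⟪x, ν x⟫^{n(p-1)/(n+p)} dμ_K(x)`. -/
def asp {n : ℕ} (p : ℝ) (K : Set (E n)) (ν : E n → E n) (κ : E n → ℝ) : ℝ :=
  ∫ x in frontier K,
    κ x ^ (p / ((n : ℝ) + p)) / ⟪x, ν x⟫ ^ ((n : ℝ) * (p - 1) / ((n : ℝ) + p))
    ∂(bdMeasure n)

/-- The convex floating body K_δ: the intersection of all closed halfspaces whose defining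
hyperplanes cut off a set of volume δ from K. -/
def floatingBody {n : ℕ} (K : Set (E n)) (δ : ℝ) : Set (E n) :=
  ⋂ (u : E n) (t : ℝ) (_ : ‖u‖ = 1 ∧ vol (K ∩ {z | t ≤ ⟪z, u⟫}) = δ),
    {z : E n | ⟪z, u⟫ ≤ t}

/-- The surface body K_{f,s}: the intersection of all closed halfspaces H⁺ whose defining
hyperplanes H cut off a set of f μ_K-measure at most s from ∂K. -/
def surfaceBody {n : ℕ} (K : Set (E n)) (f : E n → ℝ) (s : ℝ) : Set (E n) :=
  ⋂ (u : E n) (t : ℝ)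
    (_ : ‖u‖ = 1 ∧ (∫ x in frontier K ∩ {z | t ≤ ⟪z, u⟫}, f x ∂(bdMeasure n)) ≤ s),
    {z : E n | ⟪z, u⟫ ≤ t}

/-- The constant c_n = 2 (|B₂^{n-1}|/(n+1))^{2/(n+1)}. -/
def cn (n : ℕ) : ℝ :=
  2 * ((volume (Metric.closedBall (0 : EuclideanSpace ℝ (Fin (n - 1))) 1)).toReal /
    ((n : ℝ) + 1)) ^ (2 / ((n : ℝ) + 1))

/-- The constant β_n = 2 |B₂^{n-1}|^{2/(n-1)}. -/
def betan (n : ℕ) : ℝ :=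
  2 * ((volume (Metric.closedBall (0 : EuclideanSpace ℝ (Fin (n - 1))) 1)).toReal) ^
    (2 / ((n : ℝ) - 1))

/-- The support function h_K(u) = sup_{x ∈ K} ⟪x, u⟫. -/
def suppFn {n : ℕ} (K : Set (E n)) (u : E n) : ℝ := sSup ((fun x => ⟪x, u⟫) '' K)

/-- The inverse Gauss map N_K⁻¹ : S^{n-1} → ∂K. -/
def gaussInv {n : ℕ} (K : Set (E n)) (ν : E n → E n) : E n → E n :=
  Function.invFunOn ν (frontier K)

/-- The curvature function f_K(u): the reciprocal of the Gaussian curvature at the boundary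
point with outer normal u. -/
def curvFn {n : ℕ} (K : Set (E n)) (ν : E n → E n) (κ : E n → ℝ) (u : E n) : ℝ :=
  1 / κ (gaussInv K ν u)

/-- The L_{-n} affine surface area
`as_{-n}(K) = max_{u ∈ S^{n-1}} f_K(u)^{1/2} h_K(u)^{(n+1)/2}`. -/
def asNegN {n : ℕ} (K : Set (E n)) (ν : E n → E n) (κ : E n → ℝ) : ℝ :=
  sSup ((fun u => curvFn K ν κ u ^ ((1 : ℝ) / 2) * suppFn K u ^ (((n : ℝ) + 1) / 2)) ''
    Metric.sphere (0 : E n) 1)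

/-- K is an ellipsoid: the image of the Euclidean unit ball under an invertible affine map. -/
def IsEllipsoid {n : ℕ} (K : Set (E n)) : Prop :=
  ∃ (L : E n ≃ₗ[ℝ] E n) (c : E n), K = (fun x => L x + c) '' Metric.closedBall (0 : E n) 1

/-- Comparison of finite measures by means of the Besicovitch covering theorem: an asymptotic
inequality on small balls around each point of `S` integrates to a global inequality. -/
theorem le_withDensity_of_closedBall_le {n : ℕ} {ρ μ : Measure (E n)} [IsFiniteMeasure ρ]
    [IsFiniteMeasure μ] {S : Set (E n)} (hS : IsCompact S) (hρ : ρ Sᶜ = 0) (hμ : μ Sᶜ = 0)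
    {f : E n → ℝ} (hf : ContinuousOn f S) (hpos : ∀ x ∈ S, 0 < f x)
    (h : ∀ x ∈ S, ∀ k : ℝ, 1 < k → ∀ᶠ r in 𝓝[>] (0 : ℝ),
      ρ (Metric.closedBall x r) ≤ ENNReal.ofReal (k * f x) * μ (Metric.closedBall x r)) :
    ρ ≤ μ.withDensity (fun x => ENNReal.ofReal (f x)) := by
  have hμS : ∀ᵐ x ∂μ, x ∈ S := by
    rw [ae_iff]; exact hμ
  obtain ⟨M, hM⟩ : ∃ M, ∀ x ∈ S, f x ≤ M := by
    obtain ⟨M, hM⟩ := (hS.image_of_continuousOn hf).bddAbove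
    exact ⟨M, fun x hx => hM (mem_image_of_mem f hx)⟩
  have hfin : ∫⁻ x, ENNReal.ofReal (f x) ∂μ ≠ ⊤ := by
    refine ne_top_of_le_ne_top (b := ∫⁻ x, ENNReal.ofReal M ∂μ) ?_ ?_
    · rw [lintegral_const]; exact ENNReal.mul_ne_top ENNReal.ofReal_ne_top (measure_ne_top _ _)
    · apply lintegral_mono_ae
      filter_upwards [hμS] with x hx using ENNReal.ofReal_le_ofReal (hM x hx)
  set w := μ.withDensity (fun x => ENNReal.ofReal (f x)) with hw
  have : IsFiniteMeasure w := isFiniteMeasure_withDensity hfin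
  have key : ∀ k : ℝ, 1 < k → ∀ s : Set (E n), ρ s ≤ ENNReal.ofReal (k ^ 2) * w s := by
    intro k hk s
    have hk0 : 0 < k := by linarith
    set ω : Measure (E n) := (ENNReal.ofReal (k ^ 2)) • w
    have : IsFiniteMeasure ω := w.smul_finite ENNReal.ofReal_ne_top
    have h1 : ρ (s ∩ S) ≤ ω (s ∩ S) := by
      refine (Besicovitch.vitaliFamily ρ).measure_le_of_frequently_le ω
        Measure.AbsolutelyContinuous.rfl _ ?_
      rintro x ⟨-, hx⟩
      apply (Besicovitch.tendsto_filterAt ρ x).frequently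
      apply Eventually.frequently
      have hlt : f x / k < f x := div_lt_self (hpos x hx) hk
      have hnear : ∀ᶠ y in 𝓝[S] x, f x / k < f y := (hf x hx).eventually (lt_mem_nhds hlt)
      obtain ⟨δ, hδ, hball⟩ := Metric.mem_nhdsWithin_iff.1 hnear
      filter_upwards [h x hx k hk, Ioo_mem_nhdsGT hδ] with r hr hrδ
      refine hr.trans ?_
      change _ ≤ ENNReal.ofReal (k ^ 2) * w (Metric.closedBall x r)
      rw [hw, withDensity_apply _ Metric.isClosed_closedBall.measurableSet]
      have h2 : ENNReal.ofReal (f x / k) * μ (Metric.closedBall x r) ≤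
          ∫⁻ y in Metric.closedBall x r, ENNReal.ofReal (f y) ∂μ := by
        rw [← setLIntegral_const]
        apply lintegral_mono_ae
        filter_upwards [ae_restrict_of_ae hμS,
          ae_restrict_mem Metric.isClosed_closedBall.measurableSet] with y hy hyb
        exact ENNReal.ofReal_le_ofReal
          (hball ⟨Metric.closedBall_subset_ball hrδ.2 hyb, hy⟩ : f x / k < f y).le
      calc ENNReal.ofReal (k * f x) * μ (Metric.closedBall x r)
          = ENNReal.ofReal (k ^ 2) * (ENNReal.ofReal (f x / k) * μ (Metric.closedBall x r)) := by
            rw [← mul_assoc, ← ENNReal.ofReal_mul (by positivity)]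
            congr 2; field_simp
        _ ≤ _ := by gcongr
    calc ρ s ≤ ρ (s ∩ S) + ρ Sᶜ := by
          refine (measure_mono ?_).trans (measure_union_le _ _)
          intro x hx
          by_cases hxS : x ∈ S
          · exact Or.inl ⟨hx, hxS⟩
          · exact Or.inr hxS
      _ = ρ (s ∩ S) := by rw [hρ, add_zero]
      _ ≤ ω (s ∩ S) := h1
      _ ≤ ω s := measure_mono inter_subset_left
      _ = _ := rfl
  refine Measure.le_iff'.2 fun s => ?_
  have hlim : Tendsto (fun k : ℝ => ENNReal.ofReal (k ^ 2) * w s) (𝓝[>] 1)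
      (𝓝 (ENNReal.ofReal (1 ^ 2) * w s)) := by
    refine ENNReal.Tendsto.mul_const ?_ (Or.inr (measure_ne_top _ _))
    refine (ENNReal.continuous_ofReal.comp (continuous_pow 2)).continuousAt.tendsto.mono_left
      nhdsWithin_le_nhds
  have := ge_of_tendsto hlim (eventually_nhdsWithin_of_forall fun k hk => key k hk s)
  simpa using this

/-- The `m`-dimensional Hausdorff measure on `ℝᵐ` is a multiple, by a factor at least one, of
Lebesgue measure. -/
theorem exists_hausdorffMeasure_eq_smul_volume (m : ℕ) :
    ∃ c : ℝ≥0, 1 ≤ c ∧ (μH[(m : ℝ)] : Measure (E m)) = c • (volume : Measure (E m)) := by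
  have hH : (μH[(m : ℝ)] : Measure (E m)).IsAddHaarMeasure := by
    have := isAddHaarMeasure_hausdorffMeasure (E := E m)
    rwa [finrank_euclideanSpace, Fintype.card_fin] at this
  refine ⟨Measure.addHaarScalarFactor μH[(m : ℝ)] volume, ?_,
    Measure.isAddLeftInvariant_eq_smul _ _⟩
  set c := Measure.addHaarScalarFactor (μH[(m : ℝ)] : Measure (E m)) volume
  have hc : (μH[(m : ℝ)] : Measure (E m)) = c • volume :=
    Measure.isAddLeftInvariant_eq_smul _ _
  set B : Set (E m) := Metric.closedBall 0 1
  have hpos : 0 < volume B := Metric.measure_closedBall_pos _ _ one_pos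
  have hfin : volume B ≠ ⊤ := (isCompact_closedBall _ _).measure_lt_top.ne
  have h1 : volume B ≤ c • volume B := by
    have h2 := ((PiLp.lipschitzWith_ofLp 2 (fun _ : Fin m => ℝ)).lipschitzOnWith
      (s := B)).hausdorffMeasure_image_le (d := m) (Nat.cast_nonneg m)
    have h3 : (μH[(m : ℝ)] : Measure (Fin m → ℝ)) = volume := by
      simpa using hausdorffMeasure_pi_real (ι := Fin m)
    rw [h3, hc] at h2
    have h4 : volume (WithLp.ofLp '' B) = volume B := by
      have := (PiLp.volume_preserving_ofLp (Fin m)).measure_preimage_equiv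
        (f := MeasurableEquiv.toLp 2 (Fin m → ℝ) |>.symm) (WithLp.ofLp '' B)
      rw [← this]
      congr 1
      exact ((WithLp.ofLp_injective 2).preimage_image B)
    rw [h4] at h2
    simpa using h2
  by_contra hlt
  push Not at hlt
  have : c • volume B < volume B := by
    rw [ENNReal.smul_def, smul_eq_mul]
    calc (c : ℝ≥0∞) * volume B < 1 * volume B :=
          ENNReal.mul_lt_mul_left hpos.ne' hfin (by exact_mod_cast hlt)
      _ = _ := one_mul _
  exact absurd h1 (not_le.2 this)

/-- The cone with apex at the origin over the set `W`. -/
def coneOver {n : ℕ} (W : Set (E n)) : Set (E n) :=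
  (fun p : ℝ × E n => p.1 • p.2) '' (Icc (0 : ℝ) 1 ×ˢ W)

theorem mem_coneOver {n : ℕ} {W : Set (E n)} {y : E n} :
    y ∈ coneOver W ↔ ∃ s : ℝ, 0 ≤ s ∧ s ≤ 1 ∧ ∃ x ∈ W, s • x = y := by
  constructor
  · rintro ⟨⟨s, x⟩, ⟨hs, hx⟩, rfl⟩
    exact ⟨s, hs.1, hs.2, x, hx, rfl⟩
  · rintro ⟨s, h0, h1, x, hx, rfl⟩
    exact ⟨(s, x), ⟨⟨h0, h1⟩, hx⟩, rfl⟩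

theorem isCompact_coneOver {n : ℕ} {W : Set (E n)} (hW : IsCompact W) :
    IsCompact (coneOver W) :=
  (isCompact_Icc.prod hW).image (by fun_prop)

/-- The identification of `ℝ × ℝᵐ` with `ℝᵐ⁺¹`. -/
def consEquiv (m : ℕ) : ℝ × (Fin m → ℝ) ≃ᵐ E (m + 1) :=
  (MeasurableEquiv.piFinSuccAbove (fun _ : Fin (m + 1) => ℝ) 0).symm.trans
    (MeasurableEquiv.toLp 2 (Fin (m + 1) → ℝ))

theorem consEquiv_apply {m : ℕ} (p : ℝ × (Fin m → ℝ)) :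
    consEquiv m p = WithLp.toLp 2 (Fin.cons p.1 p.2 : Fin (m + 1) → ℝ) := by
  simp [consEquiv, MeasurableEquiv.piFinSuccAbove, Fin.insertNthEquiv]

theorem measurePreserving_consEquiv (m : ℕ) :
    MeasurePreserving (consEquiv m) volume volume :=
  ((volume_preserving_piFinSuccAbove (fun _ : Fin (m + 1) => ℝ) 0).symm).trans
    (PiLp.volume_preserving_toLp (Fin (m + 1)))

theorem consEquiv_smul {m : ℕ} (a : ℝ) (p : ℝ × (Fin m → ℝ)) :
    consEquiv m (a • p) = a • consEquiv m p := by
  rw [consEquiv_apply, consEquiv_apply, ← WithLp.toLp_smul]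
  congr 1
  ext i
  refine Fin.cases ?_ (fun i => ?_) i <;> simp

theorem consEquiv_zero {m : ℕ} (p : ℝ × (Fin m → ℝ)) : consEquiv m p 0 = p.1 := by
  simp [consEquiv_apply]

open scoped Pointwise in
/-- The volume of a pyramid with base in the hyperplane `y 0 = h`. -/
theorem volume_coneOver_of_coord {m : ℕ} {h : ℝ} (hh : 0 < h) {W : Set (E (m + 1))}
    (hW : IsCompact W) (hWh : ∀ y ∈ W, y 0 = h) :
    ((m + 1 : ℕ) : ℝ≥0∞) * volume (coneOver W) =
      ENNReal.ofReal h * volume {z : Fin m → ℝ | consEquiv m (h, z) ∈ W} := by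
  set W₀ := {z : Fin m → ℝ | consEquiv m (h, z) ∈ W}
  have hC : MeasurableSet (coneOver W) := (isCompact_coneOver hW).measurableSet
  have hslice : ∀ s : ℝ, s ≠ 0 → volume (Prod.mk s ⁻¹' (consEquiv m ⁻¹' coneOver W)) =
      (Ioc 0 h).indicator (fun s => ENNReal.ofReal ((s / h) ^ m) * volume W₀) s := by
    intro s hs0
    by_cases hs : s ∈ Ioc 0 h
    · rw [indicator_of_mem hs]
      have hpos : 0 < s / h := div_pos hs.1 hh
      have : Prod.mk s ⁻¹' (consEquiv m ⁻¹' coneOver W) = (s / h) • W₀ := by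
        ext z
        rw [mem_smul_set_iff_inv_smul_mem₀ hpos.ne']
        have hcons : consEquiv m (h, (s / h)⁻¹ • z) = (s / h)⁻¹ • consEquiv m (s, z) := by
          rw [← consEquiv_smul]
          congr 1
          refine Prod.ext ?_ rfl
          simp only [Prod.smul_mk, smul_eq_mul]
          field_simp
        change consEquiv m (s, z) ∈ coneOver W ↔ consEquiv m (h, (s / h)⁻¹ • z) ∈ W
        rw [hcons, mem_coneOver]
        constructor
        · rintro ⟨a, ha0, ha1, x, hx, hax⟩
          have h0 := congrArg (fun y : E (m + 1) => y 0) hax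
          simp only [PiLp.smul_apply, smul_eq_mul, consEquiv_zero, hWh x hx] at h0
          have ha : a = s / h := by rw [← h0]; field_simp
          rw [← hax, ha, smul_smul, inv_mul_cancel₀ hpos.ne', one_smul]
          exact hx
        · intro hx
          refine ⟨s / h, hpos.le, (div_le_one hh).2 hs.2, _, hx, ?_⟩
          rw [smul_smul, mul_inv_cancel₀ hpos.ne', one_smul]
      rw [this, Measure.addHaar_smul, Module.finrank_fin_fun, abs_of_pos (pow_pos hpos m)]
    · rw [indicator_of_notMem hs]
      have : Prod.mk s ⁻¹' (consEquiv m ⁻¹' coneOver W) = ∅ := by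
        rw [eq_empty_iff_forall_notMem]
        intro z hz
        obtain ⟨a, ha0, ha1, x, hx, hax⟩ := mem_coneOver.1 hz
        have h0 := congrArg (fun y : E (m + 1) => y 0) hax
        simp only [PiLp.smul_apply, smul_eq_mul, consEquiv_zero, hWh x hx] at h0
        have h1 : 0 ≤ s := h0 ▸ mul_nonneg ha0 hh.le
        have h2 : s ≤ h := by rw [← h0]; nlinarith
        exact hs ⟨lt_of_le_of_ne h1 (Ne.symm hs0), h2⟩
      rw [this, measure_empty]
  have hint : ∫⁻ s in Ioc 0 h, ENNReal.ofReal ((s / h) ^ m) = ENNReal.ofReal (h / (m + 1)) := by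
    rw [← ofReal_integral_eq_lintegral_ofReal]
    · congr 1
      rw [← intervalIntegral.integral_of_le hh.le]
      simp only [div_pow]
      rw [intervalIntegral.integral_div, integral_pow]
      field_simp
      ring
    · exact ((continuous_id.div_const h).pow m).integrableOn_Ioc
    · filter_upwards [ae_restrict_mem measurableSet_Ioc] with s hs
      exact pow_nonneg (div_nonneg hs.1.le hh.le) m
  have hvol : volume (coneOver W) = ENNReal.ofReal (h / (m + 1)) * volume W₀ := by
    rw [← (measurePreserving_consEquiv m).measure_preimage hC.nullMeasurableSet,
      Measure.volume_eq_prod, Measure.prod_apply ((consEquiv m).measurable hC)]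
    calc ∫⁻ s, volume (Prod.mk s ⁻¹' (consEquiv m ⁻¹' coneOver W))
        = ∫⁻ s, (Ioc 0 h).indicator
            (fun s => ENNReal.ofReal ((s / h) ^ m) * volume W₀) s := by
          refine lintegral_congr_ae ?_
          filter_upwards [compl_mem_ae_iff.2 (measure_singleton (0 : ℝ))] with s hs
          exact hslice s hs
      _ = _ := by
          rw [lintegral_indicator measurableSet_Ioc, lintegral_mul_const, hint]
          exact ENNReal.measurable_ofReal.comp ((measurable_id.div_const h).pow_const m)
  rw [hvol, ← mul_assoc]
  congr 1
  rw [← ENNReal.ofReal_natCast, ← ENNReal.ofReal_mul (by positivity)]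
  congr 1
  push_cast
  field_simp

theorem coneOver_image_linear {n : ℕ} (L : E n →ₗ[ℝ] E n) (W : Set (E n)) :
    coneOver (L '' W) = L '' coneOver W := by
  ext y
  simp only [mem_coneOver, mem_image]
  constructor
  · rintro ⟨s, h0, h1, _, ⟨x, hx, rfl⟩, rfl⟩
    exact ⟨s • x, ⟨s, h0, h1, x, hx, rfl⟩, map_smul _ _ _⟩
  · rintro ⟨_, ⟨s, h0, h1, x, hx, rfl⟩, rfl⟩
    exact ⟨s, h0, h1, _, ⟨x, hx, rfl⟩, (map_smul _ _ _).symm⟩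

/-- The volume of a pyramid: base times height divided by the dimension. -/
theorem volume_coneOver_of_inner_eq {m : ℕ} {c : ℝ≥0}
    (hc : (μH[(m : ℝ)] : Measure (E m)) = c • (volume : Measure (E m)))
    {u : E (m + 1)} (hu : ‖u‖ = 1) {h : ℝ} (hh : 0 < h) {W : Set (E (m + 1))}
    (hW : IsCompact W) (hWh : ∀ y ∈ W, ⟪y, u⟫ = h) :
    ((m + 1 : ℕ) : ℝ≥0∞) * c * volume (coneOver W) = ENNReal.ofReal h * μH[(m : ℝ)] W := by
  obtain ⟨b, hb⟩ : ∃ b : OrthonormalBasis (Fin (m + 1)) ℝ (E (m + 1)), b 0 = u := by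
    obtain ⟨b, hb⟩ := Orthonormal.exists_orthonormalBasis_extension_of_card_eq (𝕜 := ℝ)
      (E := E (m + 1)) (ι := Fin (m + 1)) (by simp) (v := fun _ => u) (s := {0}) (by
        constructor
        · intro i; simpa using hu
        · intro i j hij; exact absurd (Subsingleton.elim i j) hij)
    exact ⟨b, hb 0 rfl⟩
  set L := b.repr
  have hLW : IsCompact (L '' W) := hW.image L.continuous
  have hL0 : ∀ y ∈ L '' W, y 0 = h := by
    rintro _ ⟨y, hy, rfl⟩
    rw [b.repr_apply_apply, hb, real_inner_comm]
    exact hWh y hy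
  have hvol : volume (coneOver (L '' W)) = volume (coneOver W) := by
    have h1 := coneOver_image_linear (L.toLinearEquiv : E (m + 1) →ₗ[ℝ] E (m + 1)) W
    have h2 : coneOver (L '' W) = L '' coneOver W := h1
    rw [h2, ← (L.measurePreserving).measure_preimage
      (hW |> isCompact_coneOver |>.image L.continuous).measurableSet.nullMeasurableSet,
      L.injective.preimage_image]
  have hbase : μH[(m : ℝ)] W =
      c * volume {z : Fin m → ℝ | consEquiv m (h, z) ∈ L '' W} := by
    set W₀ := {z : Fin m → ℝ | consEquiv m (h, z) ∈ L '' W}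
    have hiso : Isometry (fun z : E m => consEquiv m (h, z.ofLp)) := by
      refine Isometry.of_dist_eq fun z z' => ?_
      simp only [consEquiv_apply, EuclideanSpace.dist_eq, Fin.sum_univ_succ]
      simp
    have himg : (fun z : E m => consEquiv m (h, z.ofLp)) '' (WithLp.ofLp ⁻¹' W₀) = L '' W := by
      ext y
      constructor
      · rintro ⟨z, hz, rfl⟩
        exact hz
      · intro hy
        have h1 : consEquiv m (h, ((consEquiv m).symm y).2) = y := by
          conv_rhs => rw [← (consEquiv m).apply_symm_apply y]
          congr 1
          refine Prod.ext ?_ rfl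
          rw [← hL0 y hy]
          conv_lhs => rw [← (consEquiv m).apply_symm_apply y]
          exact consEquiv_zero _
        refine ⟨WithLp.toLp 2 ((consEquiv m).symm y).2, ?_, h1⟩
        change consEquiv m (h, _) ∈ L '' W
        rw [h1]
        exact hy
    have hm0 : (0 : ℝ) ≤ m := Nat.cast_nonneg m
    have hW₀ : MeasurableSet W₀ :=
      ((consEquiv m).measurable.comp measurable_prodMk_left) hLW.measurableSet
    rw [← L.isometry.hausdorffMeasure_image (Or.inl hm0) W, ← himg,
      hiso.hausdorffMeasure_image (Or.inl hm0), hc, Measure.smul_apply,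
      (PiLp.volume_preserving_ofLp (Fin m)).measure_preimage hW₀.nullMeasurableSet]
    rfl
  rw [hbase, ← hvol, mul_right_comm, volume_coneOver_of_coord hh hLW hL0]
  ring

theorem hausdorffMeasure_image_le_of_norm_sub_le {n m : ℕ} {k : ℝ} (hk : 0 ≤ k)
    {f : E n → E n} {A : Set (E n)} (hf : ∀ x ∈ A, ∀ y ∈ A, ‖f x - f y‖ ≤ k * ‖x - y‖) :
    μH[(m : ℝ)] (f '' A) ≤ ENNReal.ofReal (k ^ m) * μH[(m : ℝ)] A := by
  have hL : LipschitzOnWith k.toNNReal f A := by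
    refine LipschitzOnWith.of_dist_le_mul fun x hx y hy => ?_
    rw [dist_eq_norm, dist_eq_norm, Real.coe_toNNReal k hk]
    exact hf x hx y hy
  have := hL.hausdorffMeasure_image_le (d := m) (Nat.cast_nonneg m)
  rwa [ENNReal.rpow_natCast, ← ENNReal.ofReal, ← ENNReal.ofReal_pow hk] at this

open scoped Pointwise in
theorem volume_coneOver_le_of_scaled {m : ℕ} {k : ℝ} (hk : 0 < k) {V W : Set (E (m + 1))}
    (hVW : ∀ x ∈ V, ∃ a : ℝ, 0 ≤ a ∧ a ≤ k ∧ ∃ y ∈ W, x = a • y) :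
    volume (coneOver V) ≤ ENNReal.ofReal (k ^ (m + 1)) * volume (coneOver W) := by
  have hsub : coneOver V ⊆ k • coneOver W := by
    intro y hy
    obtain ⟨s, h0, h1, x, hx, rfl⟩ := mem_coneOver.1 hy
    obtain ⟨a, ha0, hak, w, hw, rfl⟩ := hVW x hx
    refine ⟨(s * (a / k)) • w, mem_coneOver.2 ⟨_, by positivity, ?_, w, hw, rfl⟩, ?_⟩
    · exact mul_le_one₀ h1 (by positivity) ((div_le_one hk).2 hak)
    · simp only [smul_smul]
      congr 1
      field_simp
  refine (measure_mono hsub).trans_eq ?_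
  rw [Measure.addHaar_smul, finrank_euclideanSpace, Fintype.card_fin,
    abs_of_pos (pow_pos hk _)]

/-- The volume of the cone over a small, almost flat set is asymptotically the area of the base
times the height divided by the dimension. -/
theorem exists_coneOver_comparison {m : ℕ} {c : ℝ≥0}
    (hc : (μH[(m : ℝ)] : Measure (E m)) = c • (volume : Measure (E m)))
    {u x₀ : E (m + 1)} (hu : ‖u‖ = 1) (hpos : 0 < ⟪x₀, u⟫) {k : ℝ} (hk : 1 < k) :
    ∃ η : ℝ, 0 < η ∧ ∀ A : Set (E (m + 1)), IsCompact A → A ⊆ Metric.closedBall x₀ η →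
      (∀ x ∈ A, ∀ y ∈ A, |⟪x - y, u⟫| ≤ η * ‖x - y‖) →
      ENNReal.ofReal ⟪x₀, u⟫ * μH[(m : ℝ)] A ≤
        ENNReal.ofReal (k ^ (2 * m + 1)) *
          (((m + 1 : ℕ) : ℝ≥0∞) * c * volume (coneOver A)) ∧
      ((m + 1 : ℕ) : ℝ≥0∞) * c * volume (coneOver A) ≤
        ENNReal.ofReal (k ^ (2 * m + 1)) * (ENNReal.ofReal ⟪x₀, u⟫ * μH[(m : ℝ)] A) := by
  set h := ⟪x₀, u⟫ with hh
  have hk0 : 0 < k := by linarith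
  set M := ‖x₀‖ + h / 2 with hM
  have hM0 : 0 ≤ M := by positivity
  set C := (2 + 4 * M) / h with hC
  have hC0 : 0 < C := by positivity
  have hkinv : 0 < 1 - 1 / k := by
    rw [sub_pos, div_lt_one hk0]; exact hk
  refine ⟨min (h / 2) ((1 - 1 / k) / C), lt_min (by positivity) (by positivity), ?_⟩
  set η := min (h / 2) ((1 - 1 / k) / C)
  intro A hA hAη hflat
  have hη0 : 0 ≤ η := (lt_min (by positivity) (by positivity)).le
  have hη1 : η ≤ h / 2 := min_le_left _ _
  have hη2 : C * η ≤ 1 - 1 / k := by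
    have : η ≤ (1 - 1 / k) / C := min_le_right _ _
    rw [le_div_iff₀ hC0] at this
    linarith
  have hk2 : 1 + C * η ≤ k := by
    have h1 : 2 - 1 / k ≤ k := by
      have : 0 ≤ (k - 1) ^ 2 / k := by positivity
      have h2 : (k - 1) ^ 2 / k = k - 2 + 1 / k := by field_simp; ring
      linarith
    linarith
  have hk3 : 1 / k ≤ 1 - C * η := by linarith
  have hin : ∀ x ∈ A, |⟪x, u⟫ - h| ≤ η := by
    intro x hx
    have : ⟪x, u⟫ - h = ⟪x - x₀, u⟫ := by rw [inner_sub_left]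
    rw [this]
    refine (abs_real_inner_le_norm _ _).trans ?_
    rw [hu, mul_one, ← dist_eq_norm]
    exact hAη hx
  have hlow : ∀ x ∈ A, h / 2 ≤ ⟪x, u⟫ := by
    intro x hx
    have := (abs_le.1 (hin x hx)).1
    linarith
  have hxpos : ∀ x ∈ A, 0 < ⟪x, u⟫ := fun x hx => by
    have := hlow x hx
    linarith
  have hnorm : ∀ x ∈ A, ‖x‖ ≤ M := by
    intro x hx
    have h1 : ‖x - x₀‖ ≤ η := by rw [← dist_eq_norm]; exact hAη hx
    have h2 : ‖x‖ ≤ ‖x₀‖ + ‖x - x₀‖ := norm_le_norm_add_norm_sub' x x₀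
    linarith
  set a : E (m + 1) → ℝ := fun x => h / ⟪x, u⟫ with ha
  have ha1 : ∀ x ∈ A, |a x - 1| ≤ 2 / h * η := by
    intro x hx
    have h1 : a x - 1 = (h - ⟪x, u⟫) / ⟪x, u⟫ := by
      rw [sub_div, div_self (hxpos x hx).ne']
    rw [h1, abs_div, abs_of_pos (hxpos x hx), abs_sub_comm, div_le_iff₀ (hxpos x hx)]
    calc |⟪x, u⟫ - h| ≤ η := hin x hx
      _ = 2 / h * η * (h / 2) := by field_simp
      _ ≤ _ := by gcongr; exact hlow x hx
  have ha2 : ∀ x ∈ A, ∀ y ∈ A, |a x - a y| ≤ 4 / h * η * ‖x - y‖ := by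
    intro x hx y hy
    have hxp := hxpos x hx
    have hyp := hxpos y hy
    have h1 : a x - a y = h * ⟪y - x, u⟫ / (⟪x, u⟫ * ⟪y, u⟫) := by
      rw [inner_sub_left]
      simp only [ha]
      field_simp
    rw [h1, abs_div, abs_mul, abs_of_pos hpos, abs_of_pos (mul_pos hxp hyp),
      div_le_iff₀ (mul_pos hxp hyp)]
    calc h * |⟪y - x, u⟫| ≤ h * (η * ‖y - x‖) := by gcongr; exact hflat y hy x hx
      _ = 4 / h * η * ‖x - y‖ * (h / 2 * (h / 2)) := by
        rw [norm_sub_rev]; field_simp; ring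
      _ ≤ _ := by
        gcongr
        · exact hlow x hx
        · exact hlow y hy
  set π : E (m + 1) → E (m + 1) := fun x => a x • x with hπ
  have hπd : ∀ x ∈ A, ∀ y ∈ A, ‖(π x - π y) - (x - y)‖ ≤ C * η * ‖x - y‖ := by
    intro x hx y hy
    have h1 : (π x - π y) - (x - y) = (a x - 1) • (x - y) + (a x - a y) • y := by
      simp only [hπ]
      module
    rw [h1]
    refine (norm_add_le _ _).trans ?_
    rw [norm_smul, norm_smul, Real.norm_eq_abs, Real.norm_eq_abs]
    calc |a x - 1| * ‖x - y‖ + |a x - a y| * ‖y‖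
        ≤ 2 / h * η * ‖x - y‖ + 4 / h * η * ‖x - y‖ * M := by
          gcongr
          · exact ha1 x hx
          · exact ha2 x hx y hy
          · exact hnorm y hy
      _ = C * η * ‖x - y‖ := by rw [hC]; field_simp
  have hCge : 2 / h ≤ C := by
    rw [hC]; gcongr; linarith
  have hak : ∀ x ∈ A, 1 / k ≤ a x ∧ a x ≤ k := by
    intro x hx
    have h1 := abs_le.1 (ha1 x hx)
    have h2 : 2 / h * η ≤ C * η := by gcongr
    constructor <;> linarith [h1.1, h1.2]
  have hup : ∀ x ∈ A, ∀ y ∈ A, ‖π x - π y‖ ≤ k * ‖x - y‖ := by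
    intro x hx y hy
    have h1 := norm_le_norm_add_norm_sub' (π x - π y) (x - y)
    have h2 := hπd x hx y hy
    have h3 : (1 + C * η) * ‖x - y‖ ≤ k * ‖x - y‖ := by gcongr
    linarith
  have hdown : ∀ x ∈ A, ∀ y ∈ A, ‖x - y‖ ≤ k * ‖π x - π y‖ := by
    intro x hx y hy
    have h1 := norm_le_norm_add_norm_sub (π x - π y) (x - y)
    have h2 := hπd x hx y hy
    have h3 : 1 / k * ‖x - y‖ ≤ (1 - C * η) * ‖x - y‖ := by gcongr
    have h4 : 1 / k * ‖x - y‖ ≤ ‖π x - π y‖ := by linarith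
    rw [one_div, inv_mul_le_iff₀ hk0] at h4
    exact h4
  have hinj : InjOn π A := by
    intro x hx y hy hxy
    have := hdown x hx y hy
    rw [hxy, sub_self, norm_zero, mul_zero] at this
    exact sub_eq_zero.1 (norm_le_zero_iff.1 this)
  have hπc : IsCompact (π '' A) := by
    refine hA.image_of_continuousOn ?_
    refine ContinuousOn.smul (f := a) (g := fun x => x) ?_ continuousOn_id
    exact continuousOn_const.div (by fun_prop) fun x hx => (hxpos x hx).ne'
  have hflat_cone := volume_coneOver_of_inner_eq hc hu hpos hπc (by
    rintro _ ⟨x, hx, rfl⟩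
    simp only [hπ, ha, real_inner_smul_left]
    exact div_mul_cancel₀ _ (hxpos x hx).ne')
  have hH1 : μH[(m : ℝ)] (π '' A) ≤ ENNReal.ofReal (k ^ m) * μH[(m : ℝ)] A :=
    hausdorffMeasure_image_le_of_norm_sub_le hk0.le hup
  have hH2 : μH[(m : ℝ)] A ≤ ENNReal.ofReal (k ^ m) * μH[(m : ℝ)] (π '' A) := by
    have h1 := hausdorffMeasure_image_le_of_norm_sub_le (m := m) (A := π '' A)
      (f := Function.invFunOn π A) hk0.le (by
        rintro _ ⟨x, hx, rfl⟩ _ ⟨y, hy, rfl⟩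
        rw [hinj.leftInvOn_invFunOn hx, hinj.leftInvOn_invFunOn hy]
        exact hdown x hx y hy)
    rwa [hinj.leftInvOn_invFunOn.image_image] at h1
  have hV1 : volume (coneOver A) ≤
      ENNReal.ofReal (k ^ (m + 1)) * volume (coneOver (π '' A)) := by
    refine volume_coneOver_le_of_scaled hk0 fun x hx => ⟨(a x)⁻¹, ?_, ?_, π x, ⟨x, hx, rfl⟩, ?_⟩
    · have := (hak x hx).1
      have : 0 < 1 / k := by positivity
      exact inv_nonneg.2 (by linarith)
    · have := (hak x hx).1
      rw [one_div] at this
      exact inv_le_of_inv_le₀ hk0 this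
    · have h1 : 0 < a x := div_pos hpos (hxpos x hx)
      simp only [hπ]
      rw [smul_smul, inv_mul_cancel₀ h1.ne', one_smul]
  have hV2 : volume (coneOver (π '' A)) ≤
      ENNReal.ofReal (k ^ (m + 1)) * volume (coneOver A) := by
    refine volume_coneOver_le_of_scaled hk0 ?_
    rintro _ ⟨x, hx, rfl⟩
    exact ⟨a x, (div_pos hpos (hxpos x hx)).le, (hak x hx).2, x, hx, rfl⟩
  have hkk : ENNReal.ofReal (k ^ (2 * m + 1)) =
      ENNReal.ofReal (k ^ m) * ENNReal.ofReal (k ^ (m + 1)) := by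
    rw [← ENNReal.ofReal_mul (by positivity)]
    congr 1; ring
  rw [hkk]
  set N : ℝ≥0∞ := ((m + 1 : ℕ) : ℝ≥0∞) * c
  constructor
  · calc ENNReal.ofReal h * μH[(m : ℝ)] A
        ≤ ENNReal.ofReal h * (ENNReal.ofReal (k ^ m) * μH[(m : ℝ)] (π '' A)) := by gcongr
      _ = ENNReal.ofReal (k ^ m) * (N * volume (coneOver (π '' A))) := by
        rw [hflat_cone]; ring
      _ ≤ ENNReal.ofReal (k ^ m) *
          (N * (ENNReal.ofReal (k ^ (m + 1)) * volume (coneOver A))) := by gcongr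
      _ = _ := by ring
  · calc N * volume (coneOver A)
        ≤ N * (ENNReal.ofReal (k ^ (m + 1)) * volume (coneOver (π '' A))) := by gcongr
      _ = ENNReal.ofReal (k ^ (m + 1)) * (N * volume (coneOver (π '' A))) := by ring
      _ = ENNReal.ofReal (k ^ (m + 1)) * (ENNReal.ofReal h * μH[(m : ℝ)] (π '' A)) := by
        rw [hflat_cone]
      _ ≤ ENNReal.ofReal (k ^ (m + 1)) *
          (ENNReal.ofReal h * (ENNReal.ofReal (k ^ m) * μH[(m : ℝ)] A)) := by gcongr
      _ = _ := by ring

theorem zero_mem_interior_of_centroid {n : ℕ} {K : Set (E n)} (hK : IsConvexBody K)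
    (hcen : CentroidAtOrigin K) : (0 : E n) ∈ interior K := by
  obtain ⟨hconv, hcomp, hne⟩ := hK
  by_contra h0
  obtain ⟨f, hf⟩ := geometric_hahn_banach_open_point hconv.interior isOpen_interior h0
  simp only [map_zero] at hf
  have hle : ∀ x ∈ K, f x ≤ 0 := by
    intro x hx
    have hx' : x ∈ closure (interior K) := by
      rw [hconv.closure_interior_eq_closure_of_nonempty_interior hne]
      exact subset_closure hx
    exact closure_minimal (fun y hy => (hf y hy).le)
      (isClosed_le f.continuous continuous_const) hx'
  have hint : IntegrableOn (fun x => x) K :=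
    continuousOn_id.integrableOn_compact hcomp
  have hzero : ∫ x in K, -f x = 0 := by
    rw [integral_neg, ContinuousLinearMap.integral_comp_comm f hint]
    have : (∫ x in K, x) = (0 : E n) := hcen
    rw [this, map_zero, neg_zero]
  rw [setIntegral_eq_zero_iff_of_nonneg_ae] at hzero
  · have hae := ae_restrict_of_ae_restrict_of_subset interior_subset hzero
    have hfalse : ∀ᵐ x ∂(volume.restrict (interior K)), False := by
      filter_upwards [hae, ae_restrict_mem isOpen_interior.measurableSet] with x hx hxi
      have := hf x hxi
      simp only [Pi.zero_apply] at hx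
      linarith
    rw [ae_iff] at hfalse
    simp only [not_false_eq_true, Set.ofPred_true, Measure.restrict_apply_univ] at hfalse
    exact (isOpen_interior.measure_pos volume hne).ne' hfalse
  · filter_upwards [ae_restrict_mem hcomp.measurableSet] with x hx
    simpa using hle x hx
  · exact (f.integrable_comp hint).neg

theorem isCompact_frontier_of_isConvexBody {n : ℕ} {K : Set (E n)} (hK : IsConvexBody K) :
    IsCompact (frontier K) :=
  hK.2.1.of_isClosed_subset isClosed_frontier hK.2.1.isClosed.frontier_subset

theorem inner_outerNormal_pos {n : ℕ} {K : Set (E n)} {ν : E n → E n} (hν : IsOuterNormal K ν)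
    (h0 : (0 : E n) ∈ interior K) {x : E n} (hx : x ∈ frontier K) : 0 < ⟪x, ν x⟫ := by
  obtain ⟨δ, hδ, hball⟩ := Metric.mem_nhds_iff.1 (mem_interior_iff_mem_nhds.1 h0)
  obtain ⟨h1, h2⟩ := hν x hx
  have hmem : (δ / 2) • ν x ∈ K := by
    apply hball
    rw [mem_ball_zero_iff, norm_smul, h1, mul_one, Real.norm_of_nonneg (by positivity)]
    linarith
  have h3 := h2 _ hmem
  rw [real_inner_smul_left, real_inner_self_eq_norm_sq, h1] at h3
  linarith

theorem bdMeasure_succ (m : ℕ) : bdMeasure (m + 1) = μH[(m : ℝ)] := by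
  unfold bdMeasure
  congr 1
  push_cast
  ring

theorem surfaceMeasure_closedBall {n : ℕ} (K : Set (E n)) (x : E n) (r : ℝ) :
    surfaceMeasure K (Metric.closedBall x r) =
      bdMeasure n (frontier K ∩ Metric.closedBall x r) := by
  rw [surfaceMeasure, Measure.restrict_apply Metric.isClosed_closedBall.measurableSet, inter_comm]

theorem surfaceMeasure_compl_frontier {n : ℕ} (K : Set (E n)) :
    surfaceMeasure K (frontier K)ᶜ = 0 := by
  rw [surfaceMeasure, Measure.restrict_apply isClosed_frontier.measurableSet.compl]
  simp

theorem eventually_forall_mem_inter_closedBall {n : ℕ} {S : Set (E n)} {x : E n}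
    {p : E n → Prop} (h : ∀ᶠ y in 𝓝[S] x, p y) :
    ∀ᶠ r in 𝓝[>] (0 : ℝ), ∀ y ∈ S ∩ Metric.closedBall x r, p y := by
  obtain ⟨δ, hδ, hball⟩ := Metric.mem_nhdsWithin_iff.1 h
  filter_upwards [Ioo_mem_nhdsGT hδ] with r hr y hy
  exact hball ⟨Metric.closedBall_subset_ball hr.2 hy.2, hy.1⟩

theorem eventually_norm_sub_le {n : ℕ} {S : Set (E n)} {x : E n} {f : E n → E n}
    (hf : ContinuousWithinAt f S x) {η : ℝ} (hη : 0 < η) :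
    ∀ᶠ r in 𝓝[>] (0 : ℝ), ∀ y ∈ S ∩ Metric.closedBall x r, ‖f y - f x‖ ≤ η := by
  apply eventually_forall_mem_inter_closedBall
  filter_upwards [hf.eventually (Metric.ball_mem_nhds _ hη)] with y hy
  rw [← dist_eq_norm]
  exact (Metric.mem_ball.1 hy).le

/-- Near a boundary point, the boundary is almost contained in the tangent hyperplane. -/
theorem eventually_abs_inner_le {n : ℕ} {K : Set (E n)} {ν : E n → E n} (hK : IsClosed K)
    (hν : IsOuterNormal K ν) (hc : ContinuousOn ν (frontier K)) {x : E n}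
    (hx : x ∈ frontier K) {η : ℝ} (hη : 0 < η) :
    ∀ᶠ r in 𝓝[>] (0 : ℝ), ∀ y ∈ frontier K ∩ Metric.closedBall x r,
      ∀ z ∈ frontier K ∩ Metric.closedBall x r, |⟪y - z, ν x⟫| ≤ η * ‖y - z‖ := by
  filter_upwards [eventually_norm_sub_le (hc x hx) hη] with r hr
  have key : ∀ y ∈ frontier K ∩ Metric.closedBall x r,
      ∀ z ∈ frontier K ∩ Metric.closedBall x r, ⟪y - z, ν x⟫ ≤ η * ‖y - z‖ := by
    intro y hy z hz
    have h1 : ⟪y - z, ν z⟫ ≤ 0 := by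
      rw [inner_sub_left]
      linarith [(hν z hz.1).2 y (hK.frontier_subset hy.1)]
    have h2 : ⟪y - z, ν x⟫ = ⟪y - z, ν z⟫ - ⟪y - z, ν z - ν x⟫ := by
      rw [inner_sub_right]; ring
    have h3 := (abs_le.1 (abs_real_inner_le_norm (y - z) (ν z - ν x))).1
    have h4 : ‖y - z‖ * ‖ν z - ν x‖ ≤ ‖y - z‖ * η := by gcongr; exact hr z hz
    linarith
  intro y hy z hz
  refine abs_le.2 ⟨?_, key y hy z hz⟩
  have h1 := key z hz y hy
  rw [← neg_sub, inner_neg_left, norm_neg] at h1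
  linarith

theorem exists_one_lt_pow_le {k : ℝ} (hk : 1 < k) (p : ℕ) : ∃ q : ℝ, 1 < q ∧ q ^ p ≤ k := by
  have h1 : Tendsto (fun q : ℝ => q ^ p) (𝓝[>] 1) (𝓝 (1 ^ p)) :=
    (continuous_pow p).continuousAt.tendsto.mono_left nhdsWithin_le_nhds
  rw [one_pow] at h1
  obtain ⟨q, hq1, hq2⟩ := ((h1.eventually (gt_mem_nhds hk)).and self_mem_nhdsWithin).exists
  exact ⟨q, hq2, hq1.le⟩

theorem eventually_image_ball_le {n : ℕ} {K : Set (E n)} {ν : E n → E n} {x : E n} {a : ℝ}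
    (ha : 0 < a) (h : IsGaussCurvatureAt K ν x a) {k : ℝ} (hk : 1 < k) :
    ∀ᶠ r in 𝓝[>] (0 : ℝ), surfaceMeasure K (Metric.ball x r) ≠ ⊤ ∧
      bdMeasure n (ν '' (frontier K ∩ Metric.ball x r)) ≤
        ENNReal.ofReal (k * a) * surfaceMeasure K (Metric.ball x r) := by
  have hlt : a < k * a := lt_mul_of_one_lt_left ha hk
  filter_upwards [h.eventually (lt_mem_nhds ha), h.eventually (gt_mem_nhds hlt)] with r h1 h2
  have hσ : surfaceMeasure K (Metric.ball x r) =
      bdMeasure n (frontier K ∩ Metric.ball x r) := by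
    rw [surfaceMeasure, Measure.restrict_apply Metric.isOpen_ball.measurableSet, inter_comm]
  rw [hσ]
  set s := bdMeasure n (frontier K ∩ Metric.ball x r)
  set v := bdMeasure n (ν '' (frontier K ∩ Metric.ball x r))
  have hs : 0 < s.toReal := by
    refine lt_of_le_of_ne ENNReal.toReal_nonneg fun h0 => ?_
    rw [← h0, div_zero] at h1
    exact h1.false
  have hv : 0 < v.toReal := by
    refine lt_of_le_of_ne ENNReal.toReal_nonneg fun h0 => ?_
    rw [← h0, zero_div] at h1
    exact h1.false
  have hs' := (ENNReal.toReal_pos_iff.1 hs).2.ne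
  have hv' := (ENNReal.toReal_pos_iff.1 hv).2.ne
  refine ⟨hs', ?_⟩
  rw [div_lt_iff₀ hs] at h2
  rw [← ENNReal.ofReal_toReal hs', ← ENNReal.ofReal_toReal hv',
    ← ENNReal.ofReal_mul (by positivity)]
  exact ENNReal.ofReal_le_ofReal h2.le

theorem eventually_image_closedBall_le {n : ℕ} {K : Set (E n)} {ν : E n → E n} {x : E n} {a : ℝ}
    (ha : 0 < a) (h : IsGaussCurvatureAt K ν x a) {k : ℝ} (hk : 1 < k) :
    ∀ᶠ r in 𝓝[>] (0 : ℝ),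
      bdMeasure n (ν '' (frontier K ∩ Metric.closedBall x r)) ≤
        ENNReal.ofReal (k * a) * surfaceMeasure K (Metric.closedBall x r) := by
  obtain ⟨r₀, hr₀, hsub⟩ := mem_nhdsGT_iff_exists_Ioo_subset.1 (eventually_image_ball_le ha h hk)
  filter_upwards [Ioo_mem_nhdsGT hr₀] with r hr
  have hlim := tendsto_measure_biInter_gt (μ := surfaceMeasure K) (s := Metric.ball x) (a := r)
    (fun r' _ => Metric.isOpen_ball.measurableSet.nullMeasurableSet)
    (fun i j _ hij => Metric.ball_subset_ball hij)
    ⟨(r + r₀) / 2, by linarith [hr.2],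
      (hsub ⟨by linarith [hr.1, hr.2], by linarith [hr.2]⟩).1⟩
  have hI : ⋂ r' > r, Metric.ball x r' = Metric.closedBall x r := by
    ext y
    simp only [mem_iInter, Metric.mem_ball, Metric.mem_closedBall]
    exact ⟨fun hy => le_of_forall_gt_imp_ge_of_dense fun b hb => (hy b hb).le,
      fun hy b hb => lt_of_le_of_lt hy hb⟩
  rw [hI] at hlim
  refine ge_of_tendsto (ENNReal.Tendsto.const_mul hlim (Or.inr ENNReal.ofReal_ne_top)) ?_
  filter_upwards [Ioo_mem_nhdsGT hr.2] with r' hr'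
  refine (measure_mono ?_).trans (hsub ⟨hr.1.trans hr'.1, hr'.2⟩).2
  gcongr
  exact Metric.closedBall_subset_ball hr'.1

theorem isFiniteMeasure_surfaceMeasure {n : ℕ} {K : Set (E n)} {ν : E n → E n} {κ : E n → ℝ}
    (hK : IsC2PlusBody K ν κ) : IsFiniteMeasure (surfaceMeasure K) := by
  refine ⟨?_⟩
  have h1 : surfaceMeasure K (frontier K) < ⊤ := by
    refine (isCompact_frontier_of_isConvexBody hK.1).measure_lt_top_of_nhdsWithin fun x hx => ?_
    obtain ⟨hcurv, hpos⟩ := hK.2.2.2.2.2 x hx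
    obtain ⟨r, hr, hr0⟩ := ((eventually_image_ball_le hpos hcurv one_lt_two).and
      self_mem_nhdsWithin).exists
    exact ⟨Metric.ball x r, mem_nhdsWithin_of_mem_nhds (Metric.ball_mem_nhds x hr0),
      hr.1.lt_top⟩
  have h2 : surfaceMeasure K univ = surfaceMeasure K (frontier K) := by
    simp [surfaceMeasure]
  rwa [h2]

theorem continuousOn_inner_outerNormal {n : ℕ} {K : Set (E n)} {ν : E n → E n}
    (hc : ContinuousOn ν (frontier K)) : ContinuousOn (fun x => ⟪x, ν x⟫) (frontier K) :=
  continuousOn_id.inner hc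

/-- The integral of the support function over the boundary is controlled by the volume. -/
theorem lintegral_inner_le_volume {m : ℕ} {c : ℝ≥0}
    (hc : (μH[(m : ℝ)] : Measure (E m)) = c • (volume : Measure (E m)))
    {K : Set (E (m + 1))} {ν : E (m + 1) → E (m + 1)} {κ : E (m + 1) → ℝ}
    (hK : IsC2PlusBody K ν κ) (h0 : (0 : E (m + 1)) ∈ interior K) :
    ∫⁻ x, ENNReal.ofReal ⟪x, ν x⟫ ∂(surfaceMeasure K) ≤
      ((m + 1 : ℕ) : ℝ≥0∞) * c * volume K := by
  obtain ⟨hbody, hν, hνc, -, -, -⟩ := id hK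
  have hKc := hbody.2.1
  have hF := isCompact_frontier_of_isConvexBody hbody
  have hσ := isFiniteMeasure_surfaceMeasure hK
  have hnhds : K ∈ 𝓝 (0 : E (m + 1)) := mem_interior_iff_mem_nhds.1 h0
  have habs : Absorbent ℝ K := absorbent_nhds_zero hnhds
  have hbdd : Bornology.IsVonNBounded ℝ K :=
    NormedSpace.isVonNBounded_of_isBounded ℝ hKc.isBounded
  set N : ℝ≥0∞ := ((m + 1 : ℕ) : ℝ≥0∞) * c with hN
  have hNtop : N ≠ ⊤ := ENNReal.mul_ne_top (ENNReal.natCast_ne_top _) ENNReal.coe_ne_top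
  set R : E (m + 1) → E (m + 1) := fun y => (gauge K y)⁻¹ • y with hR
  have hRm : Measurable R :=
    (continuous_gauge hbody.1 hnhds).measurable.inv.smul measurable_id
  have hgpos : ∀ y : E (m + 1), y ≠ 0 → 0 < gauge K y := fun y hy =>
    (gauge_pos habs hbdd).2 hy
  have hRF : ∀ y : E (m + 1), y ≠ 0 → R y ∈ frontier K := by
    intro y hy
    rw [← gauge_eq_one_iff_mem_frontier hbody.1 hnhds, hR]
    simp only
    rw [gauge_smul_of_nonneg (inv_nonneg.2 (hgpos y hy).le), smul_eq_mul,
      inv_mul_cancel₀ (hgpos y hy).ne']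
  have hK0 : MeasurableSet (K \ {0}) := hKc.measurableSet.diff (measurableSet_singleton _)
  set μ : Measure (E (m + 1)) := N • (volume.restrict (K \ {0})).map R with hμdef
  have hμs : ∀ s, MeasurableSet s → μ s = N * volume (R ⁻¹' s ∩ (K \ {0})) := by
    intro s hs
    rw [hμdef, Measure.smul_apply, Measure.map_apply hRm hs,
      Measure.restrict_apply (hRm hs), smul_eq_mul]
  have hfinK : IsFiniteMeasure (volume.restrict (K \ {0})) :=
    isFiniteMeasure_restrict.2
      (ne_top_of_le_ne_top hKc.measure_lt_top.ne (measure_mono sdiff_subset))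
  have hμfin : IsFiniteMeasure μ := Measure.smul_finite _ hNtop
  have hμF : μ (frontier K)ᶜ = 0 := by
    rw [hμs _ isClosed_frontier.measurableSet.compl]
    have : R ⁻¹' (frontier K)ᶜ ∩ (K \ {0}) = ∅ := by
      rw [eq_empty_iff_forall_notMem]
      rintro y ⟨hy1, hy2⟩
      exact hy1 (hRF y hy2.2)
    rw [this, measure_empty, mul_zero]
  have hpos : ∀ x ∈ frontier K, 0 < ⟪x, ν x⟫ := fun x hx => inner_outerNormal_pos hν h0 hx
  have hhc := continuousOn_inner_outerNormal hνc
  have hcomp := le_withDensity_of_closedBall_le (ρ := surfaceMeasure K) (μ := μ) hF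
    (surfaceMeasure_compl_frontier K) hμF (f := fun x => ⟪x, ν x⟫⁻¹)
    (hhc.inv₀ fun x hx => (hpos x hx).ne') (fun x hx => inv_pos.2 (hpos x hx)) (by
      intro x hx k hk
      obtain ⟨q, hq1, hqk⟩ := exists_one_lt_pow_le hk (2 * m + 1)
      obtain ⟨η, hη, hcone⟩ := exists_coneOver_comparison hc (hν x hx).1 (hpos x hx) hq1
      filter_upwards [eventually_abs_inner_le hKc.isClosed hν hνc hx hη,
        Ioo_mem_nhdsGT hη] with r hflat hr
      set A := frontier K ∩ Metric.closedBall x r with hA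
      have h1 := (hcone A (hF.inter_right Metric.isClosed_closedBall)
        (inter_subset_right.trans (Metric.closedBall_subset_closedBall hr.2.le)) hflat).1
      have h2 : N * volume (coneOver A) ≤ μ (Metric.closedBall x r) := by
        rw [hμs _ Metric.isClosed_closedBall.measurableSet]
        refine mul_le_mul' le_rfl ?_
        have hsub : coneOver A \ {0} ⊆ R ⁻¹' Metric.closedBall x r ∩ (K \ {0}) := by
          rintro y ⟨hy, hy0⟩
          obtain ⟨s, hs0, hs1, z, hz, rfl⟩ := mem_coneOver.1 hy
          have hs : 0 < s := lt_of_le_of_ne hs0 fun h => hy0 (by rw [← h, zero_smul]; rfl)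
          have hz1 : gauge K z = 1 := (gauge_eq_one_iff_mem_frontier hbody.1 hnhds).2 hz.1
          refine ⟨?_, ?_, hy0⟩
          · have : R (s • z) = z := by
              simp only [hR]
              rw [gauge_smul_of_nonneg hs0, hz1, smul_eq_mul, mul_one, smul_smul,
                inv_mul_cancel₀ hs.ne', one_smul]
            rw [mem_preimage, this]
            exact hz.2
          · have hzK : z ∈ K := hKc.isClosed.frontier_subset hz.1
            have := hbody.1 (interior_subset h0) hzK (sub_nonneg.2 hs1) hs0 (by ring)
            simpa using this
        calc volume (coneOver A) = volume (coneOver A \ {0}) :=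
              (measure_sdiff_null (measure_singleton _)).symm
          _ ≤ _ := measure_mono hsub
      rw [surfaceMeasure_closedBall, bdMeasure_succ, ENNReal.ofReal_mul (by linarith),
        ENNReal.ofReal_inv_of_pos (hpos x hx), mul_assoc, mul_left_comm,
        ← ENNReal.mul_le_iff_le_inv (by simpa using hpos x hx) ENNReal.ofReal_ne_top]
      refine h1.trans ?_
      gcongr)
  have hmeas : AEMeasurable (fun x => ENNReal.ofReal ⟪x, ν x⟫⁻¹) μ := by
    have h1 : AEMeasurable (fun x => ⟪x, ν x⟫⁻¹) (μ.restrict (frontier K)) :=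
      (hhc.inv₀ fun x hx => (hpos x hx).ne').aemeasurable isClosed_frontier.measurableSet
    rw [Measure.restrict_eq_self_of_ae_mem (by rw [ae_iff]; exact hμF)] at h1
    exact h1.ennreal_ofReal
  have hmeas' : AEMeasurable (fun x => ENNReal.ofReal ⟪x, ν x⟫) μ := by
    have h1 : AEMeasurable (fun x => ⟪x, ν x⟫) (μ.restrict (frontier K)) :=
      hhc.aemeasurable isClosed_frontier.measurableSet
    rw [Measure.restrict_eq_self_of_ae_mem (by rw [ae_iff]; exact hμF)] at h1
    exact h1.ennreal_ofReal
  calc ∫⁻ x, ENNReal.ofReal ⟪x, ν x⟫ ∂(surfaceMeasure K)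
      ≤ ∫⁻ x, ENNReal.ofReal ⟪x, ν x⟫ ∂(μ.withDensity fun x => ENNReal.ofReal ⟪x, ν x⟫⁻¹) :=
        lintegral_mono' hcomp le_rfl
    _ = ∫⁻ x, ENNReal.ofReal ⟪x, ν x⟫⁻¹ * ENNReal.ofReal ⟪x, ν x⟫ ∂μ :=
        lintegral_withDensity_eq_lintegral_mul₀ hmeas hmeas'
    _ = ∫⁻ _, 1 ∂μ := by
        refine lintegral_congr_ae ?_
        have hae : ∀ᵐ x ∂μ, x ∈ frontier K := by rw [ae_iff]; exact hμF
        filter_upwards [hae] with x hx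
        rw [← ENNReal.ofReal_mul (inv_nonneg.2 (hpos x hx).le),
          inv_mul_cancel₀ (hpos x hx).ne', ENNReal.ofReal_one]
    _ = μ univ := by rw [lintegral_const, one_mul]
    _ ≤ N * volume K := by
        rw [hμs _ MeasurableSet.univ]
        gcongr
        exact inter_subset_right.trans sdiff_subset

theorem continuousOn_invFunOn {n : ℕ} {S S' : Set (E n)} (hS : IsCompact S) {f : E n → E n}
    (hf : ContinuousOn f S) (hbij : BijOn f S S') : ContinuousOn (Function.invFunOn f S) S' := by
  rw [continuousOn_iff_isClosed]
  intro t ht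
  refine ⟨f '' (S ∩ t), ((hS.inter_right ht).image_of_continuousOn
    (hf.mono inter_subset_left)).isClosed, ?_⟩
  ext y
  constructor
  · rintro ⟨hy, hyS⟩
    refine ⟨⟨_, ⟨hbij.surjOn.mapsTo_invFunOn hyS, hy⟩, ?_⟩, hyS⟩
    exact hbij.surjOn.rightInvOn_invFunOn hyS
  · rintro ⟨⟨x, hx, rfl⟩, hyS⟩
    refine ⟨?_, hyS⟩
    rw [mem_preimage, hbij.injOn.leftInvOn_invFunOn hx.1]
    exact hx.2

theorem isClosed_polarBody {n : ℕ} (K : Set (E n)) : IsClosed (polarBody K) := by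
  have : polarBody K = ⋂ x ∈ K, {y | ⟪x, y⟫ ≤ 1} := by
    ext y; simp [polarBody]
  rw [this]
  exact isClosed_biInter fun x _ => isClosed_le (by fun_prop) continuous_const

theorem isBounded_polarBody {n : ℕ} {K : Set (E n)} (h0 : (0 : E n) ∈ interior K) :
    Bornology.IsBounded (polarBody K) := by
  obtain ⟨δ, hδ, hball⟩ := Metric.mem_nhds_iff.1 (mem_interior_iff_mem_nhds.1 h0)
  refine (Metric.isBounded_closedBall (x := (0 : E n)) (r := 2 / δ)).subset fun y hy => ?_
  rw [mem_closedBall_zero_iff]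
  by_cases hy0 : y = 0
  · rw [hy0, norm_zero]; positivity
  have hn : 0 < ‖y‖ := norm_pos_iff.2 hy0
  have h1 := hy ((δ / 2 / ‖y‖) • y) (hball (by
    rw [mem_ball_zero_iff, norm_smul, Real.norm_of_nonneg (by positivity),
      div_mul_cancel₀ _ hn.ne']
    linarith))
  rw [real_inner_smul_left, real_inner_self_eq_norm_sq] at h1
  have h2 : δ / 2 / ‖y‖ * ‖y‖ ^ 2 = δ / 2 * ‖y‖ := by field_simp
  rw [h2] at h1
  rw [le_div_iff₀ hδ]
  linarith

theorem abs_inner_sub_le_of_norm_eq_one {n : ℕ} {u v w : E n} (hv : ‖v‖ = 1) (hw : ‖w‖ = 1)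
    {η : ℝ} (hvu : ‖v - u‖ ≤ η) (hwu : ‖w - u‖ ≤ η) : |⟪v - w, u⟫| ≤ η * ‖v - w‖ := by
  have h1 : ⟪v - w, v + w⟫ = (0 : ℝ) := by
    rw [inner_sub_left, inner_add_right, inner_add_right, real_inner_self_eq_norm_sq,
      real_inner_self_eq_norm_sq, hv, hw, real_inner_comm]
    ring
  have h2 : ⟪v - w, u⟫ = -(⟪v - w, v - u⟫ + ⟪v - w, w - u⟫) / 2 := by
    rw [inner_add_right] at h1
    rw [inner_sub_right, inner_sub_right]
    linarith
  have h3 := abs_real_inner_le_norm (v - w) (v - u)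
  have h4 := abs_real_inner_le_norm (v - w) (w - u)
  have h5 : ‖v - w‖ * ‖v - u‖ ≤ ‖v - w‖ * η := by gcongr
  have h6 : ‖v - w‖ * ‖w - u‖ ≤ ‖v - w‖ * η := by gcongr
  rw [abs_le] at h3 h4 ⊢
  constructor <;> linarith [h3.1, h3.2, h4.1, h4.2]

open scoped Pointwise in
/-- The volume of the polar body is controlled by a curvature integral over the boundary. -/
theorem volume_polarBody_le_lintegral {m : ℕ} {c : ℝ≥0}
    (hc : (μH[(m : ℝ)] : Measure (E m)) = c • (volume : Measure (E m)))
    {K : Set (E (m + 1))} {ν : E (m + 1) → E (m + 1)} {κ : E (m + 1) → ℝ}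
    (hK : IsC2PlusBody K ν κ) (h0 : (0 : E (m + 1)) ∈ interior K) :
    ((m + 1 : ℕ) : ℝ≥0∞) * c * volume (polarBody K) ≤
      ∫⁻ x, ENNReal.ofReal (κ x / ⟪x, ν x⟫ ^ (m + 1)) ∂(surfaceMeasure K) := by
  obtain ⟨hbody, hν, hνc, hκc, hbij, hcurv⟩ := id hK
  have hKc := hbody.2.1
  have hF := isCompact_frontier_of_isConvexBody hbody
  have hσ := isFiniteMeasure_surfaceMeasure hK
  have hpos : ∀ x ∈ frontier K, 0 < ⟪x, ν x⟫ := fun x hx => inner_outerNormal_pos hν h0 hx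
  have hhc := continuousOn_inner_outerNormal hνc
  set N : ℝ≥0∞ := ((m + 1 : ℕ) : ℝ≥0∞) * c with hN
  have hNtop : N ≠ ⊤ := ENNReal.mul_ne_top (ENNReal.natCast_ne_top _) ENNReal.coe_ne_top
  set g := Function.invFunOn ν (frontier K)
  set T : E (m + 1) → E (m + 1) := fun y => g (‖y‖⁻¹ • y) with hT
  have hsph : ∀ y : E (m + 1), y ≠ 0 → ‖y‖⁻¹ • y ∈ Metric.sphere (0 : E (m + 1)) 1 := by
    intro y hy
    rw [mem_sphere_zero_iff_norm]
    exact norm_smul_inv_norm (𝕜 := ℝ) hy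
  have hTc : ContinuousOn T {0}ᶜ := by
    refine (continuousOn_invFunOn hF hνc hbij).comp ?_ fun y hy => hsph y hy
    exact (continuousOn_id.norm.inv₀ fun y hy => norm_ne_zero_iff.2 hy).smul continuousOn_id
  set P := polarBody K \ {0} with hP
  have hPm : MeasurableSet P :=
    (isClosed_polarBody K).measurableSet.diff (measurableSet_singleton _)
  have hTm : AEMeasurable T (volume.restrict P) :=
    (hTc.mono fun y hy => hy.2).aemeasurable hPm
  set ρ : Measure (E (m + 1)) := N • (volume.restrict P).map T with hρdef
  have hρs : ∀ s, MeasurableSet s → ρ s = N * volume (T ⁻¹' s ∩ P) := by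
    intro s hs
    rw [hρdef, Measure.smul_apply, Measure.map_apply_of_aemeasurable hTm hs,
      Measure.restrict_apply' hPm, smul_eq_mul]
  have hfinP : IsFiniteMeasure (volume.restrict P) :=
    isFiniteMeasure_restrict.2 ((isBounded_polarBody h0).subset sdiff_subset).measure_lt_top.ne
  have hρfin : IsFiniteMeasure ρ := Measure.smul_finite _ hNtop
  have hTF : ∀ y : E (m + 1), y ≠ 0 → T y ∈ frontier K ∧ ν (T y) = ‖y‖⁻¹ • y := fun y hy =>
    ⟨hbij.surjOn.mapsTo_invFunOn (hsph y hy), hbij.surjOn.rightInvOn_invFunOn (hsph y hy)⟩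
  have hρF : ρ (frontier K)ᶜ = 0 := by
    rw [hρs _ isClosed_frontier.measurableSet.compl]
    have : T ⁻¹' (frontier K)ᶜ ∩ P = ∅ := by
      rw [eq_empty_iff_forall_notMem]
      rintro y ⟨hy1, hy2⟩
      exact hy1 (hTF y hy2.2).1
    rw [this, measure_empty, mul_zero]
  have hcomp := le_withDensity_of_closedBall_le (ρ := ρ) (μ := surfaceMeasure K) hF hρF
    (surfaceMeasure_compl_frontier K) (f := fun x => κ x / ⟪x, ν x⟫ ^ (m + 1))
    (hκc.div (hhc.pow _) fun x hx => (pow_pos (hpos x hx) _).ne')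
    (fun x hx => div_pos (hcurv x hx).2 (pow_pos (hpos x hx) _)) (by
      intro x hx k hk
      have hxp := hpos x hx
      obtain ⟨q, hq1, hqk⟩ := exists_one_lt_pow_le hk (3 * m + 3)
      have hq0 : 0 < q := by linarith
      have hu : ‖ν x‖ = 1 := (hν x hx).1
      have huu : ⟪ν x, ν x⟫ = (1 : ℝ) := by rw [real_inner_self_eq_norm_sq, hu, one_pow]
      obtain ⟨η, hη, hcone⟩ := exists_coneOver_comparison hc hu (x₀ := ν x)
        (by rw [huu]; exact one_pos) hq1
      have hnear : ∀ᶠ y in 𝓝[frontier K] x, ⟪x, ν x⟫ / q < ⟪y, ν y⟫ :=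
        (hhc x hx).eventually (lt_mem_nhds (div_lt_self hxp hq1))
      filter_upwards [eventually_norm_sub_le (hνc x hx) hη,
        eventually_forall_mem_inter_closedBall hnear,
        eventually_image_closedBall_le (hcurv x hx).2 (hcurv x hx).1 hq1] with r hr1 hr2 hr3
      set A := frontier K ∩ Metric.closedBall x r with hA
      have h1 := (hcone (ν '' A)
        ((hF.inter_right Metric.isClosed_closedBall).image_of_continuousOn
          (hνc.mono inter_subset_left))
        (by
          rintro _ ⟨y, hy, rfl⟩
          rw [Metric.mem_closedBall, dist_eq_norm]
          exact hr1 y hy)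
        (by
          rintro _ ⟨y, hy, rfl⟩ _ ⟨z, hz, rfl⟩
          exact abs_inner_sub_le_of_norm_eq_one (hν y hy.1).1 (hν z hz.1).1
            (hr1 y hy) (hr1 z hz))).2
      rw [huu, ENNReal.ofReal_one, one_mul] at h1
      have hsub : T ⁻¹' Metric.closedBall x r ∩ P ⊆ (q / ⟪x, ν x⟫) • coneOver (ν '' A) := by
        rintro y ⟨hy, hyP, hy0⟩
        have hy0' : y ≠ 0 := hy0
        have hn : 0 < ‖y‖ := norm_pos_iff.2 hy0'
        obtain ⟨hTy, hνTy⟩ := hTF y hy0'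
        have hTA : T y ∈ A := ⟨hTy, hy⟩
        have hyeq : ‖y‖ • ν (T y) = y := by
          rw [hνTy, smul_smul, mul_inv_cancel₀ hn.ne', one_smul]
        have h2 : ‖y‖ * ⟪T y, ν (T y)⟫ ≤ 1 := by
          rw [← real_inner_smul_right, hyeq]
          exact hyP _ (hKc.isClosed.frontier_subset hTy)
        have h3 := (hr2 _ hTA).le
        refine ⟨(‖y‖ * (⟪x, ν x⟫ / q)) • ν (T y),
          mem_coneOver.2 ⟨_, by positivity, ?_, _, mem_image_of_mem ν hTA, rfl⟩, ?_⟩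
        · refine le_trans ?_ h2
          gcongr
        · have : q / ⟪x, ν x⟫ * (‖y‖ * (⟪x, ν x⟫ / q)) = ‖y‖ := by field_simp
          simp only [smul_smul]
          rw [this, hyeq]
      have h4 : ρ (Metric.closedBall x r) ≤
          ENNReal.ofReal ((q / ⟪x, ν x⟫) ^ (m + 1)) * (N * volume (coneOver (ν '' A))) := by
        rw [hρs _ Metric.isClosed_closedBall.measurableSet, mul_left_comm]
        gcongr
        refine (measure_mono hsub).trans_eq ?_
        rw [Measure.addHaar_smul, finrank_euclideanSpace, Fintype.card_fin,
          abs_of_pos (by positivity)]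
      rw [bdMeasure_succ] at hr3
      have hκ := (hcurv x hx).2
      calc ρ (Metric.closedBall x r)
          ≤ ENNReal.ofReal ((q / ⟪x, ν x⟫) ^ (m + 1)) * (N * volume (coneOver (ν '' A))) := h4
        _ ≤ ENNReal.ofReal ((q / ⟪x, ν x⟫) ^ (m + 1)) * (ENNReal.ofReal (q ^ (2 * m + 1)) *
              (ENNReal.ofReal (q * κ x) * surfaceMeasure K (Metric.closedBall x r))) := by
            refine mul_le_mul' le_rfl (h1.trans ?_)
            gcongr
        _ = ENNReal.ofReal (q ^ (3 * m + 3) * (κ x / ⟪x, ν x⟫ ^ (m + 1))) *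
              surfaceMeasure K (Metric.closedBall x r) := by
            rw [← mul_assoc, ← mul_assoc, ← ENNReal.ofReal_mul (by positivity),
              ← ENNReal.ofReal_mul (by positivity)]
            congr 2
            rw [div_pow]
            field_simp
            ring
        _ ≤ _ := by gcongr)
  calc N * volume (polarBody K) = ρ univ := by
        rw [hρs _ MeasurableSet.univ, preimage_univ, univ_inter, hP,
          measure_sdiff_null (measure_singleton _)]
    _ ≤ (surfaceMeasure K).withDensity
          (fun x => ENNReal.ofReal (κ x / ⟪x, ν x⟫ ^ (m + 1))) univ := hcomp univ
    _ = _ := by rw [withDensity_apply _ MeasurableSet.univ, Measure.restrict_univ]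

theorem div_pow_eq_rpow_mul_rpow {n : ℕ} {k h t : ℝ} (hk : 0 < k) (hh : 0 < h)
    (ht : t < -(n : ℝ)) :
    k / h ^ n = (k ^ (t / ((n : ℝ) + t)) / h ^ ((n : ℝ) * (t - 1) / ((n : ℝ) + t))) ^
      (((n : ℝ) + t) / t) * h ^ (-((n : ℝ) / t)) := by
  have hn : (0 : ℝ) ≤ n := Nat.cast_nonneg n
  have ht0 : t ≠ 0 := by linarith
  have hnt : (n : ℝ) + t ≠ 0 := by linarith
  rw [Real.div_rpow (by positivity) (by positivity), ← Real.rpow_mul hk.le, ← Real.rpow_mul hh.le]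
  have e1 : t / ((n : ℝ) + t) * (((n : ℝ) + t) / t) = 1 := by field_simp
  have e2 : (n : ℝ) * (t - 1) / ((n : ℝ) + t) * (((n : ℝ) + t) / t) = n + -((n : ℝ) / t) := by
    field_simp
    ring
  rw [e1, e2, Real.rpow_one, Real.rpow_add hh, Real.rpow_natCast]
  have : h ^ (-((n : ℝ) / t)) ≠ 0 := (Real.rpow_pos_of_pos hh _).ne'
  field_simp

theorem asp_eq_integral_surfaceMeasure {n : ℕ} (p : ℝ) (K : Set (E n)) (ν : E n → E n)
    (κ : E n → ℝ) :
    asp p K ν κ = ∫ x, κ x ^ (p / ((n : ℝ) + p)) /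
      ⟪x, ν x⟫ ^ ((n : ℝ) * (p - 1) / ((n : ℝ) + p)) ∂(surfaceMeasure K) := rfl

/-- `n|K°| (n|K|)^{n/t} ≤ as_t(K)^{(n+t)/t}` for t < −n and K of class C²₊. -/
theorem statement11 (n : ℕ)
    (K : Set (E n)) (ν : E n → E n) (κ : E n → ℝ)
    (hK : IsC2PlusBody K ν κ) (hcen : CentroidAtOrigin K)
    (t : ℝ) (ht : t < -(n : ℝ)) :
    (n : ℝ) * vol (polarBody K) * ((n : ℝ) * vol K) ^ ((n : ℝ) / t) ≤
      asp t K ν κ ^ (((n : ℝ) + t) / t) := by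
  rcases n with _ | m
  · have hKu : K = univ := Subsingleton.eq_univ_of_nonempty (hK.1.2.2.mono interior_subset)
    have hasp : asp t K ν κ = 0 := by simp [asp, hKu]
    rw [hasp]
    simp only [Nat.cast_zero, zero_mul]
    exact Real.rpow_nonneg le_rfl _
  obtain ⟨hbody, hν, hνc, hκc, -, hcurv⟩ := id hK
  have h0 := zero_mem_interior_of_centroid hbody hcen
  obtain ⟨c, hc1, hc⟩ := exists_hausdorffMeasure_eq_smul_volume m
  have hσ := isFiniteMeasure_surfaceMeasure hK
  have hpos : ∀ x ∈ frontier K, 0 < ⟪x, ν x⟫ := fun x hx => inner_outerNormal_pos hν h0 hx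
  have hκpos : ∀ x ∈ frontier K, 0 < κ x := fun x hx => (hcurv x hx).2
  have hhc := continuousOn_inner_outerNormal hνc
  have hFc := isCompact_frontier_of_isConvexBody hbody
  set σ := surfaceMeasure K with hσdef
  have hae : ∀ᵐ x ∂σ, x ∈ frontier K := by
    rw [ae_iff]; exact surfaceMeasure_compl_frontier K
  have hσr : σ.restrict (frontier K) = σ := Measure.restrict_eq_self_of_ae_mem hae
  set d : ℝ := ((m + 1 : ℕ) : ℝ) with hd
  have hd0 : 0 < d := by positivity
  have ht0 : t < 0 := by linarith
  set F : E (m + 1) → ℝ := fun x =>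
    κ x ^ (t / (d + t)) / ⟪x, ν x⟫ ^ (d * (t - 1) / (d + t)) with hF
  have hFcont : ContinuousOn F (frontier K) := by
    refine (hκc.rpow_const fun x hx => Or.inl (hκpos x hx).ne').div
      (hhc.rpow_const fun x hx => Or.inl (hpos x hx).ne') fun x hx => ?_
    exact (Real.rpow_pos_of_pos (hpos x hx) _).ne'
  have hFpos : ∀ x ∈ frontier K, 0 < F x := fun x hx =>
    div_pos (Real.rpow_pos_of_pos (hκpos x hx) _) (Real.rpow_pos_of_pos (hpos x hx) _)
  have hFint : Integrable F σ := by
    have := hFcont.integrableOn_compact (μ := σ) hFc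
    rwa [IntegrableOn, hσr] at this
  have hFae : 0 ≤ᵐ[σ] F := by
    filter_upwards [hae] with x hx using (hFpos x hx).le
  have hasp : ∫⁻ x, ENNReal.ofReal (F x) ∂σ = ENNReal.ofReal (asp t K ν κ) := by
    rw [asp_eq_integral_surfaceMeasure, ofReal_integral_eq_lintegral_ofReal hFint hFae]
  have hasp0 : 0 ≤ asp t K ν κ := by
    rw [asp_eq_integral_surfaceMeasure]
    exact integral_nonneg_of_ae hFae
  have hhm : AEMeasurable (fun x => ⟪x, ν x⟫) σ := by
    have := hhc.aemeasurable (μ := σ) isClosed_frontier.measurableSet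
    rwa [hσr] at this
  set a : ℝ := (d + t) / t with ha
  set b : ℝ := -(d / t) with hb
  have ha0 : 0 ≤ a := div_nonneg_of_nonpos (by linarith) ht0.le
  have hb0 : 0 ≤ b := by
    rw [hb, neg_nonneg]
    exact div_nonpos_of_nonneg_of_nonpos hd0.le ht0.le
  have hab : a + b = 1 := by
    rw [ha, hb, add_div, div_self ht0.ne]
    ring
  set N : ℝ≥0∞ := ((m + 1 : ℕ) : ℝ≥0∞) * c with hN
  have hNtop : N ≠ ⊤ := ENNReal.mul_ne_top (ENNReal.natCast_ne_top _) ENNReal.coe_ne_top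
  have hmain : N * volume (polarBody K) ≤
      ENNReal.ofReal (asp t K ν κ) ^ a * (N * volume K) ^ b := by
    calc N * volume (polarBody K)
        ≤ ∫⁻ x, ENNReal.ofReal (κ x / ⟪x, ν x⟫ ^ (m + 1)) ∂σ :=
          volume_polarBody_le_lintegral hc hK h0
      _ = ∫⁻ x, ENNReal.ofReal (F x) ^ a * ENNReal.ofReal ⟪x, ν x⟫ ^ b ∂σ := by
          refine lintegral_congr_ae ?_
          filter_upwards [hae] with x hx
          have hFx := (hFpos x hx).le
          rw [ENNReal.ofReal_rpow_of_nonneg hFx ha0,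
            ENNReal.ofReal_rpow_of_nonneg (hpos x hx).le hb0,
            ← ENNReal.ofReal_mul (Real.rpow_nonneg hFx _),
            div_pow_eq_rpow_mul_rpow (hκpos x hx) (hpos x hx) ht]
      _ ≤ (∫⁻ x, ENNReal.ofReal (F x) ∂σ) ^ a * (∫⁻ x, ENNReal.ofReal ⟪x, ν x⟫ ∂σ) ^ b :=
          ENNReal.lintegral_mul_norm_pow_le hFint.aemeasurable.ennreal_ofReal
            hhm.ennreal_ofReal ha0 hb0 hab
      _ ≤ _ := by
          rw [hasp]
          gcongr
          exact lintegral_inner_le_volume hc hK h0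
  have hKtop : volume K ≠ ⊤ := hbody.2.1.measure_lt_top.ne
  have hreal : d * c * vol (polarBody K) ≤ asp t K ν κ ^ a * (d * c * vol K) ^ b := by
    have := ENNReal.toReal_mono (ENNReal.mul_ne_top
      (ENNReal.rpow_ne_top_of_nonneg ha0 ENNReal.ofReal_ne_top)
      (ENNReal.rpow_ne_top_of_nonneg hb0 (ENNReal.mul_ne_top hNtop hKtop))) hmain
    simp only [hN, ENNReal.toReal_mul, ← ENNReal.toReal_rpow, ENNReal.toReal_ofReal hasp0,
      ENNReal.toReal_natCast, ENNReal.coe_toReal] at this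
    exact this
  have hcR : (1 : ℝ) ≤ c := by exact_mod_cast hc1
  have hV : 0 < d * vol K := by
    refine mul_pos hd0 (ENNReal.toReal_pos ?_ hKtop)
    exact ((isOpen_interior.measure_pos volume hbody.2.2).trans_le
      (measure_mono interior_subset)).ne'
  have hcb : (c : ℝ) ^ b ≤ c := by
    conv_rhs => rw [← Real.rpow_one (c : ℝ)]
    exact Real.rpow_le_rpow_of_exponent_le hcR (by linarith)
  have hAa : 0 ≤ asp t K ν κ ^ a := Real.rpow_nonneg hasp0 _
  have hP : d * vol (polarBody K) ≤ asp t K ν κ ^ a * (d * vol K) ^ b := by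
    have h1 : (d * c * vol K) ^ b = c ^ b * (d * vol K) ^ b := by
      rw [← Real.mul_rpow (by positivity) hV.le]
      congr 1
      ring
    have hc0 : (0 : ℝ) < c := by linarith
    refine le_of_mul_le_mul_left ?_ hc0
    calc (c : ℝ) * (d * vol (polarBody K)) = d * c * vol (polarBody K) := by ring
      _ ≤ asp t K ν κ ^ a * (c ^ b * (d * vol K) ^ b) := by rw [← h1]; exact hreal
      _ ≤ asp t K ν κ ^ a * (c * (d * vol K) ^ b) := by gcongr
      _ = _ := by ring
  calc d * vol (polarBody K) * (d * vol K) ^ (d / t)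
      ≤ asp t K ν κ ^ a * (d * vol K) ^ b * (d * vol K) ^ (d / t) := by gcongr
    _ = asp t K ν κ ^ a := by
      rw [mul_assoc, ← Real.rpow_add hV, hb, neg_add_cancel, Real.rpow_zero, mul_one]
end LpAffine
end
end

section
/- Let K ⊂ ℝ^n be a convex body of class C²₊ with centroid at the origin, and let p, s be real numbers, each different from −n. If n(s−p)/((n+p)(n+s)) ≥ 0, then as_p(K) ≤ as_{−n}(K)^{2n(s−p)/((n+p)(n+s))} · as_s(K); if n(s−p)/((n+p)(n+s)) ≤ 0, then as_p(K) ≥ as_{−n}(K)^{2n(s−p)/((n+p)(n+s))} · as_s(K). -/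
open MeasureTheory Filter Set
open scoped RealInnerProductSpace Topology NNReal ENNReal

noncomputable section

namespace LpAffine

/-- Monotonicity of the integral over a compact set for positive continuous functions, valid even
if the set has infinite measure (both integrals are then zero). -/
lemma setIntegral_mono_of_continuousOn_pos {α : Type*} [TopologicalSpace α] [MeasurableSpace α]
    [OpensMeasurableSpace α] [T2Space α] [SecondCountableTopology α] {μ : Measure α} {S : Set α}
    (hS : IsCompact S) {f g : α → ℝ} (hf : ContinuousOn f S) (hg : ContinuousOn g S)
    (hf0 : ∀ x ∈ S, 0 < f x) (hfg : ∀ x ∈ S, f x ≤ g x) :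
    ∫ x in S, f x ∂μ ≤ ∫ x in S, g x ∂μ := by
  by_cases hfi : IntegrableOn f S μ
  · have hgi : IntegrableOn g S μ := by
      have h := hfi.continuousOn_mul (hg.div hf fun x hx => (hf0 x hx).ne') hS
      refine h.congr_fun (fun x hx => ?_) hS.measurableSet
      exact div_mul_cancel₀ _ (hf0 x hx).ne'
    exact setIntegral_mono_on hfi hgi hS.measurableSet hfg
  · rw [integral_undef hfi]
    exact setIntegral_nonneg hS.measurableSet fun x hx => (hf0 x hx).le.trans (hfg x hx)

lemma suppFn_eq_of_forall_le {n : ℕ} {K : Set (E n)} {x u : E n} (hx : x ∈ K)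
    (h : ∀ z ∈ K, ⟪z, u⟫ ≤ ⟪x, u⟫) : suppFn K u = ⟪x, u⟫ :=
  IsGreatest.csSup_eq ⟨⟨x, hx, rfl⟩, by rintro _ ⟨z, hz, rfl⟩; exact h z hz⟩

/-- Interior points lie strictly below a supporting hyperplane. -/
lemma inner_lt_of_mem_interior {n : ℕ} {K : Set (E n)} {u z : E n} {c : ℝ} (hu : u ≠ 0)
    (h : ∀ z ∈ K, ⟪z, u⟫ ≤ c) (hz : z ∈ interior K) : ⟪z, u⟫ < c := by
  have hlim : Tendsto (fun t : ℝ => z + t • u) (𝓝[>] 0) (𝓝 z) := by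
    have : Continuous fun t : ℝ => z + t • u := by fun_prop
    simpa using (this.tendsto 0).mono_left nhdsWithin_le_nhds
  obtain ⟨t, htK, ht⟩ :=
    ((hlim.eventually (mem_interior_iff_mem_nhds.1 hz)).and self_mem_nhdsWithin).exists
  have h1 := h _ htK
  rw [inner_add_left, real_inner_smul_left] at h1
  have h2 : 0 < t * ⟪u, u⟫ := mul_pos ht (real_inner_self_pos.2 hu)
  linarith

/-- The support function of a convex body with centroid at the origin is positive. -/
lemma pos_of_forall_inner_le {n : ℕ} {K : Set (E n)} (hK : IsConvexBody K)
    (hcen : CentroidAtOrigin K) {u : E n} {c : ℝ} (hu : u ≠ 0) (h : ∀ z ∈ K, ⟪z, u⟫ ≤ c) :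
    0 < c := by
  obtain ⟨-, hKc, hKi⟩ := hK
  have hid : IntegrableOn (fun z : E n => z) K := continuousOn_id.integrableOn_compact hKc
  have hin : IntegrableOn (fun z : E n => ⟪z, u⟫) K :=
    ContinuousOn.integrableOn_compact hKc (by fun_prop)
  have hconst : IntegrableOn (fun _ : E n => c) K :=
    ContinuousOn.integrableOn_compact hKc (by fun_prop)
  have hzero : ∫ z in K, ⟪z, u⟫ = 0 := by
    have := integral_inner (𝕜 := ℝ) hid u
    rw [show (∫ z in K, z) = 0 from hcen, inner_zero_right] at this
    simpa only [real_inner_comm] using this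
  have hpos : 0 < ∫ z in K, (c - ⟪z, u⟫) := by
    rw [setIntegral_pos_iff_support_of_nonneg_ae (f := fun z => c - ⟪z, u⟫) _ (hconst.sub hin)]
    · refine (isOpen_interior.measure_pos volume hKi).trans_le (measure_mono fun z hz => ?_)
      exact ⟨(sub_pos.2 (inner_lt_of_mem_interior hu h hz)).ne', interior_subset hz⟩
    · filter_upwards [ae_restrict_mem hKc.measurableSet] with z hz
      exact sub_nonneg.2 (h z hz)
  rw [integral_sub hconst hin, hzero, sub_zero, setIntegral_const, smul_eq_mul] at hpos
  exact pos_of_mul_pos_right hpos measureReal_nonneg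

/-- The integrands of `as_p` and `as_s` differ by a power of the integrand of `as_{-n}`. -/
lemma integrand_eq {n p s a b : ℝ} (hp : n + p ≠ 0) (hs : n + s ≠ 0) (ha : 0 < a) (hb : 0 < b) :
    a ^ (p / (n + p)) / b ^ (n * (p - 1) / (n + p)) =
      ((1 / a) ^ ((1 : ℝ) / 2) * b ^ ((n + 1) / 2)) ^ (2 * n * (s - p) / ((n + p) * (n + s))) *
        (a ^ (s / (n + s)) / b ^ (n * (s - 1) / (n + s))) := by
  rw [one_div a, Real.inv_rpow ha.le, ← Real.rpow_neg ha.le, Real.mul_rpow (by positivity)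
    (by positivity), ← Real.rpow_mul ha.le, ← Real.rpow_mul hb.le,
    div_eq_mul_inv (a ^ (p / (n + p))), div_eq_mul_inv (a ^ (s / (n + s))),
    ← Real.rpow_neg hb.le, ← Real.rpow_neg hb.le, mul_mul_mul_comm,
    ← Real.rpow_add ha, ← Real.rpow_add hb]
  congr 2 <;> field_simp <;> ring

/-- Comparison of `as_p` and `as_s` via the L_{−n} affine surface area. -/
theorem statement17 (n : ℕ)
    (K : Set (E n)) (ν : E n → E n) (κ : E n → ℝ)
    (hK : IsC2PlusBody K ν κ) (hcen : CentroidAtOrigin K)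
    (p s : ℝ) (hp : p ≠ -(n : ℝ)) (hs : s ≠ -(n : ℝ)) :
    ((0 : ℝ) ≤ (n : ℝ) * (s - p) / (((n : ℝ) + p) * ((n : ℝ) + s)) →
      asp p K ν κ ≤
        asNegN K ν κ ^ (2 * (n : ℝ) * (s - p) / (((n : ℝ) + p) * ((n : ℝ) + s))) *
          asp s K ν κ)
    ∧ ((n : ℝ) * (s - p) / (((n : ℝ) + p) * ((n : ℝ) + s)) ≤ 0 →
      asNegN K ν κ ^ (2 * (n : ℝ) * (s - p) / (((n : ℝ) + p) * ((n : ℝ) + s))) *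
          asp s K ν κ ≤ asp p K ν κ) := by
  obtain ⟨hKb, hν, hνc, hκc, hbij, hκ⟩ := hK
  have hKcl : IsClosed K := hKb.2.1.isClosed
  have hFK : frontier K ⊆ K := hKcl.frontier_subset
  have hF : IsCompact (frontier K) := hKb.2.1.of_isClosed_subset isClosed_frontier hFK
  rcases (frontier K).eq_empty_or_nonempty with hemp | ⟨x₀, hx₀⟩
  · simp [asp, hemp]
  have hp' : (n : ℝ) + p ≠ 0 := fun h => hp (by linarith)
  have hs' : (n : ℝ) + s ≠ 0 := fun h => hs (by linarith)
  have hq : ∀ x ∈ frontier K, 0 < ⟪x, ν x⟫ := fun x hx =>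
    pos_of_forall_inner_le hKb hcen (norm_ne_zero_iff.1 (by simp [(hν x hx).1])) (hν x hx).2
  have hqc : ContinuousOn (fun x => ⟪x, ν x⟫) (frontier K) := continuousOn_id.inner hνc
  have hκ0 : ∀ x ∈ frontier K, 0 < κ x := fun x hx => (hκ x hx).2
  set g : E n → ℝ := fun x =>
    (1 / κ x) ^ ((1 : ℝ) / 2) * ⟪x, ν x⟫ ^ (((n : ℝ) + 1) / 2) with hg
  have hgc : ContinuousOn g (frontier K) :=
    ((continuousOn_const.div hκc fun x hx => (hκ0 x hx).ne').rpow_const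
      fun x hx => Or.inl (one_div_pos.2 (hκ0 x hx)).ne').mul
      (hqc.rpow_const fun x hx => Or.inl (hq x hx).ne')
  have hg0 : ∀ x ∈ frontier K, 0 < g x := fun x hx =>
    mul_pos (Real.rpow_pos_of_pos (one_div_pos.2 (hκ0 x hx)) _) (Real.rpow_pos_of_pos (hq x hx) _)
  have hM : asNegN K ν κ = sSup (g '' frontier K) := by
    rw [asNegN, ← hbij.image_eq, image_image]
    refine congrArg sSup (image_congr fun x hx => ?_)
    simp only [hg, curvFn, gaussInv, hbij.injOn.leftInvOn_invFunOn hx,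
      suppFn_eq_of_forall_le (hFK hx) (hν x hx).2]
  have hgM : ∀ x ∈ frontier K, g x ≤ asNegN K ν κ := fun x hx =>
    hM ▸ le_csSup (hF.image_of_continuousOn hgc).bddAbove (mem_image_of_mem g hx)
  have hM0 : 0 < asNegN K ν κ := (hg0 x₀ hx₀).trans_le (hgM x₀ hx₀)
  have hfc : ∀ r : ℝ, ContinuousOn (fun x => κ x ^ (r / ((n : ℝ) + r)) /
      ⟪x, ν x⟫ ^ ((n : ℝ) * (r - 1) / ((n : ℝ) + r))) (frontier K) := fun r =>
    (hκc.rpow_const fun x hx => Or.inl (hκ0 x hx).ne').div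
      (hqc.rpow_const fun x hx => Or.inl (hq x hx).ne')
      fun x hx => (Real.rpow_pos_of_pos (hq x hx) _).ne'
  have hf0 : ∀ r : ℝ, ∀ x ∈ frontier K, 0 < κ x ^ (r / ((n : ℝ) + r)) /
      ⟪x, ν x⟫ ^ ((n : ℝ) * (r - 1) / ((n : ℝ) + r)) := fun r x hx =>
    div_pos (Real.rpow_pos_of_pos (hκ0 x hx) _) (Real.rpow_pos_of_pos (hq x hx) _)
  have he : 2 * (n : ℝ) * (s - p) / (((n : ℝ) + p) * ((n : ℝ) + s)) =
      2 * ((n : ℝ) * (s - p) / (((n : ℝ) + p) * ((n : ℝ) + s))) := by ring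
  simp only [asp, ← integral_const_mul]
  constructor
  · intro h
    refine setIntegral_mono_of_continuousOn_pos hF (hfc p) (continuousOn_const.mul (hfc s))
      (hf0 p) fun x hx => ?_
    rw [integrand_eq hp' hs' (hκ0 x hx) (hq x hx)]
    exact mul_le_mul_of_nonneg_right (Real.rpow_le_rpow (hg0 x hx).le (hgM x hx) (by linarith))
      (hf0 s x hx).le
  · intro h
    refine setIntegral_mono_of_continuousOn_pos hF (continuousOn_const.mul (hfc s)) (hfc p)
      (fun x hx => mul_pos (Real.rpow_pos_of_pos hM0 _) (hf0 s x hx)) fun x hx => ?_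
    rw [integrand_eq hp' hs' (hκ0 x hx) (hq x hx)]
    exact mul_le_mul_of_nonneg_right
      (Real.rpow_le_rpow_of_nonpos (hg0 x hx) (hgM x hx) (by linarith)) (hf0 s x hx).le
end LpAffine
end
end
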